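/- For the AV-rule with lexicographic tie-breaking, if |N| > |C|, then a sincere-PNE always exists: there is a ballot profile A such that for every voter i the ballot A_i is sincere and a best response (BR) to A_{-i}. -/

import Mathlib

open Finset

/-- The 0-indexed rank of candidate `c` within committee `W` with respect to the utility `u`:
the number of members of `W` strictly preferred to `c`.  Thus the most preferred member of `W`
has rank `0`. -/
noncomputable def owaRank {C : Type*} (u : C → ℝ) (W : Finset C) (c : C) : ℕ :=
  (W.filter fun c' => u c < u c').card

/-- The OWA set-extension utility determined by the weights `lam` (where `lam 0` is the weight
`λ₁` put on the most preferred committee member, `lam 1` is `λ₂`, and so on) and the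
utility function `u`. -/
noncomputable def owaUtil {C : Type*} (lam : ℕ → ℝ) (u : C → ℝ) (W : Finset C) : ℝ :=
  ∑ c ∈ W, lam (owaRank u W c) * u c

/-- The approval score of candidate `c` under the ballot profile `A`. -/
def score {N C : Type*} [Fintype N] [DecidableEq C] (A : N → Finset C) (c : C) : ℕ :=
  (Finset.univ.filter fun i => c ∈ A i).card

/-- Candidate `c` is ranked above candidate `c'` by the best-`k` scoring rule with scoring
function `g`, with ties broken by the priority order: `c < c'` means `c` has higher
priority (`c ▷ c'`). -/
def beats {N C : Type*} [Fintype N] [DecidableEq C] [LT C]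
    (g : C → ℕ → ℝ) (A : N → Finset C) (c c' : C) : Prop :=
  g c' (score A c') < g c (score A c) ∨
    (g c (score A c) = g c' (score A c') ∧ c < c')

open Classical in
/-- The winning committee: the `k` top-ranked candidates. -/
noncomputable def winners {N C : Type*} [Fintype N] [Fintype C] [DecidableEq C] [LT C]
    (g : C → ℕ → ℝ) (k : ℕ) (A : N → Finset C) : Finset C :=
  Finset.univ.filter fun c => (Finset.univ.filter fun c' => beats g A c' c).card < k

/-- `B` is a best-response ballot of voter `i` against the other voters' ballots in `A`. -/
def BestResponse {N C : Type*} [Fintype N] [DecidableEq N] [Fintype C] [DecidableEq C] [LT C]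
    (g : C → ℕ → ℝ) (k : ℕ) (lam : ℕ → ℝ) (u : C → ℝ)
    (A : N → Finset C) (i : N) (B : Finset C) : Prop :=
  ∀ B' : Finset C,
    owaUtil lam u (winners g k (Function.update A i B')) ≤
      owaUtil lam u (winners g k (Function.update A i B))

/-- `B` is a minimal best-response ballot of voter `i`. -/
def MinimalBestResponse {N C : Type*} [Fintype N] [DecidableEq N] [Fintype C] [DecidableEq C]
    [LT C] (g : C → ℕ → ℝ) (k : ℕ) (lam : ℕ → ℝ) (u : C → ℝ)
    (A : N → Finset C) (i : N) (B : Finset C) : Prop :=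
  BestResponse g k lam u A i B ∧
    ∀ B' : Finset C, BestResponse g k lam u A i B' → B.card ≤ B'.card

/-- A ballot profile is a lazy pure Nash equilibrium if every voter's ballot is a minimal
best response to the other voters' ballots. -/
def LazyPNE {N C : Type*} [Fintype N] [DecidableEq N] [Fintype C] [DecidableEq C] [LT C]
    (g : C → ℕ → ℝ) (k : ℕ) (lam : N → ℕ → ℝ) (u : N → C → ℝ) (A : N → Finset C) : Prop :=
  ∀ i, MinimalBestResponse g k (lam i) (u i) A i (A i)

/-- A ballot is sincere if every approved candidate is preferred to every unapproved one. -/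
def Sincere {C : Type*} (u : C → ℝ) (B : Finset C) : Prop :=
  ∀ c ∈ B, ∀ c' ∉ B, u c' < u c

section Rank

variable {C L : Type*} [LinearOrder L]

/-- The number of members of `W` with a larger key than `c`. -/
def rankBy (v : C → L) (W : Finset C) (c : C) : ℕ :=
  (W.filter fun c' => v c < v c').card

theorem rankBy_lt_rankBy {v : C → L} {W : Finset C} {c d : C} (hd : d ∈ W) (h : v c < v d) :
    rankBy v W d < rankBy v W c := by
  refine Finset.card_lt_card (Finset.ssubset_iff_of_subset ?_ |>.2 ⟨d, by simp [hd, h], by simp⟩)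
  intro x hx
  simp only [Finset.mem_filter] at hx ⊢
  exact ⟨hx.1, h.trans hx.2⟩

theorem rankBy_lt_card {v : C → L} {W : Finset C} {c : C} (hc : c ∈ W) :
    rankBy v W c < W.card :=
  Finset.card_lt_card
    (Finset.ssubset_iff_of_subset (Finset.filter_subset _ _) |>.2 ⟨c, hc, by simp⟩)

theorem rankBy_injOn {v : C → L} (hv : Function.Injective v) (W : Finset C) :
    Set.InjOn (rankBy v W) W := by
  intro c hc d hd h
  by_contra hne
  rcases lt_or_gt_of_ne (hv.ne hne) with hlt | hlt
  · exact (rankBy_lt_rankBy hd hlt).ne' h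
  · exact (rankBy_lt_rankBy hc hlt).ne h

theorem image_rankBy {v : C → L} (hv : Function.Injective v) (W : Finset C) :
    W.image (rankBy v W) = Finset.range W.card := by
  refine Finset.eq_of_subset_of_card_le ?_ ?_
  · intro n hn
    obtain ⟨c, hc, rfl⟩ := Finset.mem_image.1 hn
    exact Finset.mem_range.2 (rankBy_lt_card hc)
  · rw [Finset.card_image_of_injOn (rankBy_injOn hv W), Finset.card_range]

theorem card_filter_rankBy_lt {v : C → L} (hv : Function.Injective v) (W : Finset C) {k : ℕ}
    (hk : k ≤ W.card) : (W.filter fun c => rankBy v W c < k).card = k := by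
  have himage : (W.filter fun c => rankBy v W c < k).image (rankBy v W) = Finset.range k := by
    ext n
    simp only [Finset.mem_image, Finset.mem_filter, Finset.mem_range]
    constructor
    · rintro ⟨c, ⟨-, hc⟩, rfl⟩
      exact hc
    · intro hn
      have hmem : n ∈ W.image (rankBy v W) := by
        rw [image_rankBy hv]
        exact Finset.mem_range.2 (hn.trans_le hk)
      obtain ⟨c, hc, rfl⟩ := Finset.mem_image.1 hmem
      exact ⟨c, ⟨hc, hn⟩, rfl⟩
  rw [← Finset.card_image_of_injOn ((rankBy_injOn hv W).mono
    (Finset.coe_subset.2 (Finset.filter_subset _ _))), himage,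
    Finset.card_range]

end Rank

/-- OWA utility with nonnegative weights is monotone under stochastic dominance. -/
theorem owaUtil_le_owaUtil {C : Type*} {lam : ℕ → ℝ} {u : C → ℝ} (hlam : ∀ n, 0 ≤ lam n)
    (hu : Function.Injective u) {W W' : Finset C} (hcard : W'.card = W.card)
    (hdom : ∀ t, (W'.filter fun c => t ≤ u c).card ≤ (W.filter fun c => t ≤ u c).card) :
    owaUtil lam u W' ≤ owaUtil lam u W := by
  classical
  have hex : ∀ c' ∈ W', ∃ c ∈ W, rankBy u W c = rankBy u W' c' := fun c' hc' => by
    rw [← Finset.mem_image, image_rankBy hu, ← hcard]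
    exact Finset.mem_range.2 (rankBy_lt_card hc')
  choose! σ hσW hσ using hex
  have hinj : Set.InjOn σ W' := fun a ha b hb hab =>
    rankBy_injOn hu W' ha hb (by rw [← hσ a ha, ← hσ b hb, hab])
  have himage : W'.image σ = W := by
    refine Finset.eq_of_subset_of_card_le (Finset.image_subset_iff.2 hσW) ?_
    rw [Finset.card_image_of_injOn hinj, hcard]
  have hle : ∀ c' ∈ W', u c' ≤ u (σ c') := by
    intro c' hc'
    by_contra! hlt
    have hupper : (W.filter fun c => u c' ≤ u c).card ≤ rankBy u W (σ c') :=
      Finset.card_le_card fun x hx => by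
        simp only [Finset.mem_filter] at hx ⊢
        exact ⟨hx.1, hlt.trans_le hx.2⟩
    have hlower : rankBy u W' c' < (W'.filter fun c => u c' ≤ u c).card := by
      refine Finset.card_lt_card
        (Finset.ssubset_iff_of_subset ?_ |>.2 ⟨c', by simp [hc'], by simp⟩)
      intro x hx
      simp only [Finset.mem_filter] at hx ⊢
      exact ⟨hx.1, hx.2.le⟩
    have := hdom (u c')
    have := hσ c' hc'
    omega
  calc owaUtil lam u W' ≤ ∑ c' ∈ W', lam (owaRank u W (σ c')) * u (σ c') := by
        refine Finset.sum_le_sum fun c' hc' => ?_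
        have hrank : owaRank u W (σ c') = owaRank u W' c' := by
          simpa only [rankBy, owaRank] using hσ c' hc'
        rw [hrank]
        exact mul_le_mul_of_nonneg_left (hle c' hc') (hlam _)
    _ = owaUtil lam u W := by
        conv_rhs => rw [owaUtil, ← himage, Finset.sum_image hinj, himage]

theorem card_filter_le_of_exchange {C : Type*} [DecidableEq C] {u : C → ℝ} {W W' : Finset C}
    (hcard : W'.card = W.card) (h : ∀ x ∈ W \ W', ∀ y ∈ W' \ W, u y ≤ u x) (t : ℝ) :
    (W'.filter fun c => t ≤ u c).card ≤ (W.filter fun c => t ≤ u c).card := by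
  by_cases hy : ∃ y ∈ W' \ W, t ≤ u y
  · obtain ⟨y, hy, hty⟩ := hy
    have hgain : ((W' \ W).filter fun c => t ≤ u c).card ≤ (W' \ W).card :=
      Finset.card_filter_le _ _
    have hloss : (W \ W').filter (fun c => t ≤ u c) = W \ W' :=
      Finset.filter_true_of_mem fun x hx => hty.trans (h x hx y hy)
    have hsplit : ∀ S T : Finset C, (S.filter fun c => t ≤ u c).card =
        ((S \ T).filter fun c => t ≤ u c).card + ((S ∩ T).filter fun c => t ≤ u c).card := by
      intro S T
      rw [← Finset.card_union_of_disjoint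
        (Finset.disjoint_filter_filter (Finset.disjoint_sdiff_inter S T)),
        ← Finset.filter_union, Finset.sdiff_union_inter]
    rw [hsplit W' W, hsplit W W', hloss, Finset.inter_comm W' W, ← Finset.card_sdiff_comm hcard]
    omega
  · push Not at hy
    refine Finset.card_le_card fun x hx => ?_
    simp only [Finset.mem_filter] at hx ⊢
    refine ⟨?_, hx.2⟩
    by_contra hxW
    exact (hy x (by simp [hx.1, hxW])).not_ge hx.2

section Winners

variable {N C : Type*} [Fintype N] [LinearOrder C]

/-- The key by which the AV-rule ranks candidates: larger keys are ranked higher. -/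
def avKey (A : N → Finset C) (c : C) : ℕ ×ₗ Cᵒᵈ := toLex (score A c, OrderDual.toDual c)

theorem avKey_injective (A : N → Finset C) : Function.Injective (avKey A) := fun _ _ h =>
  congrArg Prod.snd (toLex.injective h)

theorem beats_iff_avKey_lt (A : N → Finset C) (c c' : C) :
    beats (fun _ n => (n : ℝ)) A c c' ↔ avKey A c' < avKey A c := by
  simp [beats, avKey, Prod.Lex.toLex_lt_toLex, eq_comm]

variable [Fintype C]

theorem winners_eq_filter_rankBy (k : ℕ) (A : N → Finset C) :
    winners (fun _ n => (n : ℝ)) k A =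
      Finset.univ.filter fun c => rankBy (avKey A) Finset.univ c < k := by
  ext c
  rw [winners, Finset.mem_filter, Finset.mem_filter]
  simp only [rankBy, beats_iff_avKey_lt]

theorem card_winners {k : ℕ} (hk : k ≤ Fintype.card C) (A : N → Finset C) :
    (winners (fun _ n => (n : ℝ)) k A).card = k := by
  rw [winners_eq_filter_rankBy]
  exact card_filter_rankBy_lt (avKey_injective A) _ hk

theorem score_le_score_of_mem_winners {k : ℕ} {A : N → Finset C} {c w : C}
    (hc : c ∈ winners (fun _ n => (n : ℝ)) k A) (hw : w ∉ winners (fun _ n => (n : ℝ)) k A) :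
    score A w ≤ score A c := by
  simp only [winners_eq_filter_rankBy, Finset.mem_filter, Finset.mem_univ, true_and,
    not_lt] at hc hw
  by_contra! hlt
  have hkey : avKey A c < avKey A w := Prod.Lex.toLex_lt_toLex.2 (Or.inl hlt)
  have := rankBy_lt_rankBy (Finset.mem_univ w) hkey
  omega

/-- A candidate outscoring every candidate outside a set `W` of size `k` wins. -/
theorem mem_winners_of_forall_score_lt {k : ℕ} (hk : k ≤ Fintype.card C) {A : N → Finset C}
    {W : Finset C} (hW : W.card = k) {w : C} (hw : w ∈ W)
    (h : ∀ c ∉ W, score A c < score A w) : w ∈ winners (fun _ n => (n : ℝ)) k A := by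
  by_contra hwin
  obtain ⟨c, hc, hcW⟩ : ∃ c ∈ winners (fun _ n => (n : ℝ)) k A, c ∉ W := by
    by_contra! hsub
    have heq := Finset.eq_of_subset_of_card_le hsub (by rw [hW, card_winners hk])
    exact hwin (heq ▸ hw)
  exact (score_le_score_of_mem_winners hc hwin).not_gt (h c hcW)

end Winners

open Classical in
/-- If there are more voters than candidates, some `k`-subset `W` is such that for each member
`c`, at least two voters find all candidates weakly preferred to `c` in `W`. -/
theorem exists_doubly_supported_committee {N C : Type*} [Fintype N] [Fintype C]
    (hNC : Fintype.card C < Fintype.card N) (u : N → C → ℝ)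
    (hu : ∀ i, Function.Injective (u i)) (k : ℕ) (hk : k ≤ Fintype.card C) :
    ∃ W : Finset C, W.card = k ∧ ∀ c ∈ W, ∃ i j, i ≠ j ∧
      (∀ d, u i c ≤ u i d → d ∈ W) ∧ (∀ d, u j c ≤ u j d → d ∈ W) := by
  induction k with
  | zero => exact ⟨∅, by simp⟩
  | succ k ih =>
    obtain ⟨W, hW, hsupp⟩ := ih (by omega)
    have hne : (Wᶜ).Nonempty := by
      rw [← Finset.card_pos, Finset.card_compl]
      omega
    choose f hfW hf using fun i => Finset.exists_max_image Wᶜ (u i) hne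
    have hprefix : ∀ i d, u i (f i) ≤ u i d → d ∈ insert (f i) W := by
      intro i d hd
      by_contra hmem
      rw [Finset.mem_insert, not_or] at hmem
      exact hmem.1 (hu i (le_antisymm (hf i d (Finset.mem_compl.2 hmem.2)) hd))
    obtain ⟨i, j, hij, hfij⟩ := Fintype.exists_ne_map_eq_of_card_lt f hNC
    refine ⟨insert (f i) W, ?_, ?_⟩
    · rw [Finset.card_insert_of_notMem (Finset.mem_compl.1 (hfW i)), hW]
    · intro c hc
      rcases Finset.mem_insert.1 hc with rfl | hc
      · exact ⟨i, j, hij, hprefix i, by simpa only [hfij] using hprefix j⟩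
      · obtain ⟨a, b, hab, ha, hb⟩ := hsupp c hc
        exact ⟨a, b, hab, fun d hd => Finset.mem_insert_of_mem (ha d hd),
          fun d hd => Finset.mem_insert_of_mem (hb d hd)⟩

/-- for the AV-rule, if there are more voters than candidates then a
sincere-PNE exists. -/
theorem statement_18 {N C : Type*} [Fintype N] [DecidableEq N] [Fintype C] [LinearOrder C]
    (hNC : Fintype.card C < Fintype.card N)
    (k : ℕ) (hk1 : 1 ≤ k) (hk2 : k ≤ Fintype.card C)
    (u : N → C → ℝ) (hu : ∀ i, Function.Injective (u i))
    (lam : N → ℕ → ℝ) (hlam : ∀ i n, 0 ≤ lam i n)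
    (hlamne : ∀ i, ∃ n < k, lam i n ≠ 0) :
    ∃ A : N → Finset C, ∀ i : N, Sincere (u i) (A i) ∧
      BestResponse (fun _ n => (n : ℝ)) k (lam i) (u i) A i (A i) := by
  classical
  obtain ⟨W, hW, hsupp⟩ := exists_doubly_supported_committee hNC u hu k hk2
  -- Every voter approves the longest prefix of their preference order lying inside `W`.
  let A : N → Finset C := fun i => Finset.univ.filter fun c => ∀ d, u i c ≤ u i d → d ∈ W
  have hA : ∀ i c, c ∈ A i ↔ ∀ d, u i c ≤ u i d → d ∈ W := by simp [A]
  have hAW : ∀ i, A i ⊆ W := fun i c hc => (hA i c).1 hc c le_rfl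
  have hscore_two : ∀ c ∈ W, 2 ≤ score A c := by
    intro c hc
    obtain ⟨a, b, hab, ha, hb⟩ := hsupp c hc
    rw [← Finset.card_pair hab]
    refine Finset.card_le_card fun x hx => ?_
    rcases Finset.mem_insert.1 hx with rfl | hx
    · simpa using (hA _ c).2 ha
    · rw [Finset.mem_singleton.1 hx]
      simpa using (hA b c).2 hb
  have hscore_zero : ∀ c ∉ W, score A c = 0 := by
    intro c hc
    rw [score, Finset.card_eq_zero, Finset.filter_eq_empty_iff]
    exact fun i _ hi => hc (hAW i hi)
  have hwin : winners (fun _ n => (n : ℝ)) k A = W := by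
    symm
    refine Finset.eq_of_subset_of_card_le (fun w hw => ?_) (by rw [hW, card_winners hk2])
    refine mem_winners_of_forall_score_lt hk2 hW hw fun c hc => ?_
    have := hscore_zero c hc
    have := hscore_two w hw
    omega
  refine ⟨A, fun i => ⟨fun c hc c' hc' => ?_, fun B => ?_⟩⟩
  · by_contra! hle
    exact hc' ((hA i c').2 fun d hd => (hA i c).1 hc d (hle.trans hd))
  · rw [Function.update_eq_self, hwin]
    have hcard : (winners (fun _ n => (n : ℝ)) k (Function.update A i B)).card = W.card := by
      rw [hW, card_winners hk2]
    refine owaUtil_le_owaUtil (hlam i) (hu i) hcard (card_filter_le_of_exchange hcard ?_)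
    intro x hx y hy
    rw [Finset.mem_sdiff] at hx hy
    suffices hxA : x ∈ A i by
      by_contra! hlt
      exact hy.2 ((hA i x).1 hxA y hlt.le)
    by_contra hxA
    refine hx.2 (mem_winners_of_forall_score_lt hk2 hW hx.1 fun c hc => ?_)
    have hc_le : score (Function.update A i B) c ≤ 1 := by
      rw [← Finset.card_singleton i]
      refine Finset.card_le_card fun j hj => ?_
      by_contra hji
      rw [Finset.mem_singleton] at hji
      rw [Finset.mem_filter, Function.update_of_ne hji] at hj
      exact hc (hAW j hj.2)
    have hx_le : score A x ≤ score (Function.update A i B) x := by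
      refine Finset.card_le_card fun j hj => ?_
      rw [Finset.mem_filter] at hj ⊢
      have hji : j ≠ i := by
        rintro rfl
        exact hxA hj.2
      exact ⟨hj.1, by rw [Function.update_of_ne hji]; exact hj.2⟩
    have := hscore_two x hx.1
    omega
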